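/- arXiv:2007.12354 — 4 statements merged into one kernel-verified Lean document; each statement's English description precedes it below -/
import Mathlib

section
/- Fix d ≥ 1 and α ∈ (0, 2), and define the unrectified kernel k_α(x, y) := −‖x − y‖^α on ℝ^d × ℝ^d. Then MMD(·,·;k_α) is a metric on P_α(ℝ^d): for all p, q ∈ P_α(ℝ^d), MMD²(p, q; k_α) = 2 E‖X − Y‖^α − E‖X − X'‖^α − E‖Y − Y'‖^α ≥ 0 (where X, X' are i.i.d. with law p, Y, Y' are i.i.d. with law q, and X, X', Y, Y' are mutually independent); MMD(p, q; k_α) = 0 if and only if p = q; MMD is symmetric; and the triangle inequality MMD(p, q; k_α) ≤ MMD(p, r; k_α) + MMD(r, q; k_α) holds for all p, q, r ∈ P_α(ℝ^d). -/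
open MeasureTheory ProbabilityTheory Filter

noncomputable def mmdSq {X : Type*} [MeasurableSpace X] (k : X → X → ℝ) (p q : Measure X) : ℝ :=
  (∫ z : X × X, k z.1 z.2 ∂(p.prod p)) + (∫ z : X × X, k z.1 z.2 ∂(q.prod q)) -
    2 * ∫ z : X × X, k z.1 z.2 ∂(p.prod q)

noncomputable def mmd {X : Type*} [MeasurableSpace X] (k : X → X → ℝ) (p q : Measure X) : ℝ :=
  Real.sqrt (mmdSq k p q)

section RieszKernel

open Real Module
open scoped RealInnerProductSpace

variable {E : Type*} [NormedAddCommGroup E] [InnerProductSpace ℝ E] [FiniteDimensional ℝ E]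
  [MeasurableSpace E] [BorelSpace E]

theorem integrable_min_one_sq_mul_norm_rpow [Nontrivial E] {α : ℝ} (hα : α ∈ Set.Ioo (0 : ℝ) 2) :
    Integrable (fun ξ : E => min 1 (‖ξ‖ ^ 2) * ‖ξ‖ ^ (-(finrank ℝ E + α))) := by
  refine (integrable_fun_norm_addHaar (volume : Measure E)
    (f := fun r : ℝ => min 1 (r ^ 2) * r ^ (-(finrank ℝ E + α)))).2 ?_
  have hn : 1 ≤ finrank ℝ E := finrank_pos
  have hpow : ∀ r : ℝ, 0 < r → r ^ (finrank ℝ E - 1) * r ^ (-(finrank ℝ E + α)) = r ^ (-1 - α) := by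
    intro r hr
    rw [← Real.rpow_natCast, ← Real.rpow_add hr]
    push_cast [hn]
    congr 1
    ring
  rw [← Set.Ioc_union_Ioi_eq_Ioi (zero_le_one' ℝ)]
  refine IntegrableOn.union ?_ ?_
  · rw [integrableOn_Ioc_iff_integrableOn_Ioo]
    refine ((intervalIntegral.integrableOn_Ioo_rpow_iff (s := 1 - α) one_pos).2
      (by linarith [hα.2])).congr_fun (fun r hr => ?_) measurableSet_Ioo
    have h1 : r ^ 2 ≤ 1 := pow_le_one₀ hr.1.le hr.2.le
    have h2 : r ^ (1 - α) = r ^ 2 * r ^ (-1 - α) := by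
      rw [← Real.rpow_natCast, ← Real.rpow_add hr.1]
      congr 1
      push_cast
      ring
    simp only [smul_eq_mul, min_eq_right h1]
    rw [h2, ← hpow r hr.1]
    ring
  · refine (integrableOn_Ioi_rpow_of_lt (a := -1 - α) (by linarith [hα.1]) one_pos).congr_fun
      (fun r hr => ?_) measurableSet_Ioi
    have h1 : 1 ≤ r ^ 2 := one_le_pow₀ (le_of_lt hr)
    simp only [smul_eq_mul, min_eq_left h1, one_mul]
    rw [hpow r (one_pos.trans hr)]

theorem integrable_one_sub_cos_inner_mul_norm_rpow [Nontrivial E] {α : ℝ}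
    (hα : α ∈ Set.Ioo (0 : ℝ) 2) (x : E) :
    Integrable (fun ξ : E => (1 - cos ⟪x, ξ⟫) * ‖ξ‖ ^ (-(finrank ℝ E + α))) := by
  refine ((integrable_min_one_sq_mul_norm_rpow hα).const_mul (2 + ‖x‖ ^ 2)).mono'
    (by fun_prop) (ae_of_all _ fun ξ => ?_)
  have h0 : 0 ≤ 1 - cos ⟪x, ξ⟫ := by linarith [cos_le_one ⟪x, ξ⟫]
  have hw : 0 ≤ ‖ξ‖ ^ (-(finrank ℝ E + α)) := by positivity
  rw [Real.norm_of_nonneg (mul_nonneg h0 hw), ← mul_assoc]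
  refine mul_le_mul_of_nonneg_right ?_ hw
  rcases le_total 1 (‖ξ‖ ^ 2) with h | h
  · rw [min_eq_left h]
    nlinarith [neg_one_le_cos ⟪x, ξ⟫, sq_nonneg ‖x‖]
  · rw [min_eq_right h]
    have h1 := one_sub_sq_div_two_le_cos (x := ⟪x, ξ⟫)
    have h2 : ⟪x, ξ⟫ ^ 2 ≤ (‖x‖ * ‖ξ‖) ^ 2 := sq_le_sq' (by
      linarith [neg_abs_le ⟪x, ξ⟫, abs_real_inner_le_norm x ξ]) (real_inner_le_norm x ξ)
    nlinarith [sq_nonneg ‖ξ‖, sq_nonneg (‖x‖ * ‖ξ‖)]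

/-- The Lévy-Khintchine integral of the isotropic stable law of index `α`, evaluated at `x`. -/
noncomputable def stableExponent (α : ℝ) (x : E) : ℝ :=
  ∫ ξ : E, (1 - cos ⟪x, ξ⟫) * ‖ξ‖ ^ (-(finrank ℝ E + α))

theorem stableExponent_eq_of_norm_eq (α : ℝ) {x y : E} (h : ‖x‖ = ‖y‖) :
    stableExponent α x = stableExponent α y := by
  set R : E ≃ₗᵢ[ℝ] E := (ℝ ∙ (x - y))ᗮ.reflection
  have hR : R x = y := Submodule.reflection_sub h
  rw [stableExponent, stableExponent, ← R.measurePreserving.integral_comp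
    R.toHomeomorph.measurableEmbedding (fun ξ => (1 - cos ⟪y, ξ⟫) * _), ← hR]
  simp only [LinearIsometryEquiv.inner_map_map, LinearIsometryEquiv.norm_map]

theorem stableExponent_smul (α : ℝ) {s : ℝ} (hs : 0 < s) (x : E) :
    stableExponent α (s • x) = s ^ α * stableExponent α x := by
  have h := Measure.integral_comp_smul (volume : Measure E)
    (fun ξ : E => (1 - cos ⟪x, ξ⟫) * ‖ξ‖ ^ (-(finrank ℝ E + α))) s
  have h1 : ∀ ξ : E, (1 - cos ⟪x, s • ξ⟫) * ‖s • ξ‖ ^ (-(finrank ℝ E + α)) =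
      s ^ (-(finrank ℝ E + α)) * ((1 - cos ⟪s • x, ξ⟫) * ‖ξ‖ ^ (-(finrank ℝ E + α))) := by
    intro ξ
    rw [real_inner_smul_left, real_inner_smul_right, norm_smul, Real.norm_of_nonneg hs.le,
      Real.mul_rpow hs.le (norm_nonneg _)]
    ring
  simp only [h1] at h
  rw [integral_const_mul, abs_of_pos (by positivity), smul_eq_mul, ← Real.rpow_natCast,
    ← Real.rpow_neg hs.le] at h
  have h2 : s ^ (-(finrank ℝ E + α)) * s ^ α = s ^ (-(finrank ℝ E : ℝ)) := by
    rw [← Real.rpow_add hs]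
    congr 1
    ring
  rw [← h2, mul_assoc] at h
  exact mul_left_cancel₀ (by positivity) h

theorem stableExponent_eq {α : ℝ} (hα : 0 < α) {e : E} (he : ‖e‖ = 1) (x : E) :
    stableExponent α x = ‖x‖ ^ α * stableExponent α e := by
  rcases eq_or_ne x 0 with rfl | hx
  · simp [stableExponent, Real.zero_rpow hα.ne']
  · rw [← stableExponent_smul α (norm_pos_iff.2 hx)]
    exact stableExponent_eq_of_norm_eq α (by simp [norm_smul, he])

theorem stableExponent_pos [Nontrivial E] {α : ℝ} (hα : α ∈ Set.Ioo (0 : ℝ) 2) {x : E}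
    (hx : x ≠ 0) : 0 < stableExponent α x := by
  have h0 : 0 ≤ fun ξ : E => (1 - cos ⟪x, ξ⟫) * ‖ξ‖ ^ (-(finrank ℝ E + α)) := fun ξ =>
    mul_nonneg (by linarith [cos_le_one ⟪x, ξ⟫]) (by positivity)
  refine (integral_nonneg h0).lt_of_ne' fun h => ?_
  rw [integral_eq_zero_iff_of_nonneg h0 (integrable_one_sub_cos_inner_mul_norm_rpow hα x)] at h
  have hcos : (fun ξ : E => cos ⟪x, ξ⟫) =ᵐ[volume] fun _ => 1 := by
    filter_upwards [h, compl_mem_ae_iff.2 (measure_singleton (0 : E))] with ξ h1 h2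
    have h3 : ‖ξ‖ ^ (-(finrank ℝ E + α)) ≠ 0 :=
      (Real.rpow_pos_of_pos (norm_pos_iff.2 h2) _).ne'
    have := (mul_eq_zero.1 h1).resolve_right h3
    linarith
  have := congrFun ((Continuous.ae_eq_iff_eq _ (by fun_prop) (by fun_prop)).1 hcos)
    ((π / ‖x‖ ^ 2) • x)
  have hx' : ‖x‖ ^ 2 ≠ 0 := by simpa using hx
  simp only [real_inner_smul_right, real_inner_self_eq_norm_sq, div_mul_cancel₀ _ hx', cos_pi]
    at this
  norm_num at this

theorem exists_lintegral_one_sub_cos_eq_norm_rpow [Nontrivial E] {α : ℝ}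
    (hα : α ∈ Set.Ioo (0 : ℝ) 2) :
    ∃ ν : Measure E, SFinite ν ∧ volume ≪ ν ∧
      ∀ x : E, ∫⁻ ξ, ENNReal.ofReal (1 - cos ⟪x, ξ⟫) ∂ν = ENNReal.ofReal (‖x‖ ^ α) := by
  obtain ⟨e, he⟩ := exists_norm_eq E zero_le_one
  have hC := stableExponent_pos hα (norm_ne_zero_iff.1 (he ▸ one_ne_zero))
  set C := stableExponent α e with hCdef
  have hm : Measurable fun ξ : E => ENNReal.ofReal (C⁻¹ * ‖ξ‖ ^ (-(finrank ℝ E + α))) := by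
    fun_prop
  refine ⟨volume.withDensity fun ξ => ENNReal.ofReal (C⁻¹ * ‖ξ‖ ^ (-(finrank ℝ E + α))),
    inferInstance, withDensity_absolutelyContinuous' hm.aemeasurable ?_, fun x => ?_⟩
  · filter_upwards [compl_mem_ae_iff.2 (measure_singleton (0 : E))] with ξ hξ
    have := Real.rpow_pos_of_pos (norm_pos_iff.2 hξ) (-(finrank ℝ E + α))
    simp only [ne_eq, ENNReal.ofReal_eq_zero, not_le]
    positivity
  · rw [lintegral_withDensity_eq_lintegral_mul _ hm (by fun_prop)]
    have hx : ‖x‖ ^ α = ∫ ξ, C⁻¹ * ((1 - cos ⟪x, ξ⟫) * ‖ξ‖ ^ (-(finrank ℝ E + α))) := by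
      rw [integral_const_mul, ← stableExponent, stableExponent_eq hα.1 he, ← hCdef]
      field_simp
    rw [hx, ofReal_integral_eq_lintegral_ofReal
      ((integrable_one_sub_cos_inner_mul_norm_rpow hα x).const_mul _)
      (ae_of_all _ fun ξ => mul_nonneg (by positivity)
        (mul_nonneg (by linarith [cos_le_one ⟪x, ξ⟫]) (by positivity)))]
    refine lintegral_congr fun ξ => ?_
    rw [Pi.mul_apply, ← ENNReal.ofReal_mul (by positivity)]
    congr 1
    ring

end RieszKernel

section EnergyDistance

open scoped RealInnerProductSpace ComplexConjugate

theorem mmdSq_neg_norm_sub_rpow {F : Type*} [NormedAddCommGroup F] [MeasurableSpace F] (α : ℝ)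
    (p q : Measure F) :
    mmdSq (fun x y => -‖x - y‖ ^ α) p q = 2 * (∫ z : F × F, ‖z.1 - z.2‖ ^ α ∂(p.prod q))
      - (∫ z : F × F, ‖z.1 - z.2‖ ^ α ∂(p.prod p))
      - ∫ z : F × F, ‖z.1 - z.2‖ ^ α ∂(q.prod q) := by
  simp only [mmdSq, integral_neg]
  ring

theorem re_charFun_mul_conj_charFun_le_one {F : Type*} [NormedAddCommGroup F]
    [InnerProductSpace ℝ F] [MeasurableSpace F] (p q : Measure F) [IsProbabilityMeasure p]
    [IsProbabilityMeasure q] (ξ : F) : (charFun p ξ * conj (charFun q ξ)).re ≤ 1 := by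
  refine (Complex.re_le_norm _).trans ?_
  rw [norm_mul, RCLike.norm_conj]
  exact mul_le_one₀ (norm_charFun_le_one ξ) (norm_nonneg _) (norm_charFun_le_one ξ)

variable {E : Type*} [NormedAddCommGroup E] [InnerProductSpace ℝ E] [FiniteDimensional ℝ E]
  [MeasurableSpace E] [BorelSpace E]

theorem integrable_norm_sub_rpow {α : ℝ} (hα : 0 < α) {p q : Measure E} [IsProbabilityMeasure p]
    [IsProbabilityMeasure q] (hp : Integrable (fun x => ‖x‖ ^ α) p)
    (hq : Integrable (fun x => ‖x‖ ^ α) q) :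
    Integrable (fun z : E × E => ‖z.1 - z.2‖ ^ α) (p.prod q) := by
  refine (((hp.comp_fst q).add (hq.comp_snd p)).const_mul (2 ^ α)).mono'
    (Measurable.aestronglyMeasurable (by fun_prop))
    (ae_of_all _ fun z => ?_)
  rw [Real.norm_of_nonneg (by positivity)]
  have h1 : ‖z.1 - z.2‖ ≤ 2 * max ‖z.1‖ ‖z.2‖ := by
    linarith [norm_sub_le z.1 z.2, le_max_left ‖z.1‖ ‖z.2‖, le_max_right ‖z.1‖ ‖z.2‖]
  calc ‖z.1 - z.2‖ ^ α ≤ (2 * max ‖z.1‖ ‖z.2‖) ^ α := by gcongr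
    _ = 2 ^ α * max ‖z.1‖ ‖z.2‖ ^ α := Real.mul_rpow (by norm_num) (by positivity)
    _ ≤ 2 ^ α * (‖z.1‖ ^ α + ‖z.2‖ ^ α) := by
      gcongr
      have := Real.rpow_nonneg (norm_nonneg z.1) α
      have := Real.rpow_nonneg (norm_nonneg z.2) α
      rcases max_cases ‖z.1‖ ‖z.2‖ with h | h <;> rw [h.1] <;> linarith

theorem integral_cos_inner_sub_prod (p q : Measure E) [IsProbabilityMeasure p]
    [IsProbabilityMeasure q] (ξ : E) :
    ∫ z : E × E, Real.cos ⟪z.1 - z.2, ξ⟫ ∂(p.prod q) =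
      (charFun p ξ * conj (charFun q ξ)).re := by
  rw [← charFun_neg, charFun_apply, charFun_apply, ← integral_prod_mul, ← RCLike.re_eq_complex_re,
    ← integral_re]
  · refine integral_congr_ae (ae_of_all _ fun z => ?_)
    simp only [← Complex.exp_add, RCLike.re_eq_complex_re]
    rw [← Complex.exp_ofReal_mul_I_re]
    congr 2
    rw [inner_sub_left, inner_neg_right]
    push_cast
    ring
  · refine Integrable.of_bound (by fun_prop) 1 (ae_of_all _ fun z => ?_)
    rw [← Complex.exp_add, ← add_mul, ← Complex.ofReal_add, Complex.norm_exp_ofReal_mul_I]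

theorem lintegral_one_sub_re_charFun_mul_conj {α : ℝ} {ν : Measure E} [SFinite ν]
    (hν : ∀ x : E, ∫⁻ ξ, ENNReal.ofReal (1 - Real.cos ⟪x, ξ⟫) ∂ν = ENNReal.ofReal (‖x‖ ^ α))
    (p q : Measure E) [IsProbabilityMeasure p] [IsProbabilityMeasure q] :
    ∫⁻ ξ, ENNReal.ofReal (1 - (charFun p ξ * conj (charFun q ξ)).re) ∂ν =
      ∫⁻ z : E × E, ENNReal.ofReal (‖z.1 - z.2‖ ^ α) ∂(p.prod q) := by
  simp_rw [← hν]
  rw [lintegral_lintegral_swap (by fun_prop)]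
  refine lintegral_congr fun ξ => ?_
  have hi : Integrable (fun z : E × E => Real.cos ⟪z.1 - z.2, ξ⟫) (p.prod q) :=
    Integrable.of_bound (by fun_prop) 1 (ae_of_all _ fun z => Real.abs_cos_le_one _)
  rw [← ofReal_integral_eq_lintegral_ofReal (f := fun z : E × E => 1 - Real.cos ⟪z.1 - z.2, ξ⟫)
    ((integrable_const 1).sub hi) (ae_of_all _ fun z => sub_nonneg.2 (Real.cos_le_one _)),
    integral_sub (integrable_const 1) hi, integral_cos_inner_sub_prod]
  simp

theorem integrable_and_integral_one_sub_re_charFun_mul_conj {α : ℝ} (hα : 0 < α) {ν : Measure E}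
    [SFinite ν]
    (hν : ∀ x : E, ∫⁻ ξ, ENNReal.ofReal (1 - Real.cos ⟪x, ξ⟫) ∂ν = ENNReal.ofReal (‖x‖ ^ α))
    {p q : Measure E} [IsProbabilityMeasure p] [IsProbabilityMeasure q]
    (hp : Integrable (fun x => ‖x‖ ^ α) p) (hq : Integrable (fun x => ‖x‖ ^ α) q) :
    Integrable (fun ξ => 1 - (charFun p ξ * conj (charFun q ξ)).re) ν ∧
      ∫ ξ, (1 - (charFun p ξ * conj (charFun q ξ)).re) ∂ν =
        ∫ z : E × E, ‖z.1 - z.2‖ ^ α ∂(p.prod q) := by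
  have h0 : ∀ ξ, 0 ≤ 1 - (charFun p ξ * conj (charFun q ξ)).re := fun ξ =>
    sub_nonneg.2 (re_charFun_mul_conj_charFun_le_one p q ξ)
  have hm : AEStronglyMeasurable (fun ξ => 1 - (charFun p ξ * conj (charFun q ξ)).re) ν :=
    Continuous.aestronglyMeasurable (by fun_prop)
  have h := lintegral_one_sub_re_charFun_mul_conj hν p q
  have hz : ∀ z : E × E, 0 ≤ ‖z.1 - z.2‖ ^ α := fun z => by positivity
  constructor
  · refine ⟨hm, ?_⟩
    rw [hasFiniteIntegral_iff_ofReal (ae_of_all _ h0), h]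
    exact (hasFiniteIntegral_iff_ofReal (ae_of_all _ hz)).1
      (integrable_norm_sub_rpow hα hp hq).2
  · rw [integral_eq_lintegral_of_nonneg_ae (ae_of_all _ h0) hm, h,
      integral_eq_lintegral_of_nonneg_ae (ae_of_all _ hz)
        (integrable_norm_sub_rpow hα hp hq).1]

theorem memLp_charFun_sub_and_mmdSq_eq_lpNorm_sq {α : ℝ} (hα : 0 < α) {ν : Measure E} [SFinite ν]
    (hν : ∀ x : E, ∫⁻ ξ, ENNReal.ofReal (1 - Real.cos ⟪x, ξ⟫) ∂ν = ENNReal.ofReal (‖x‖ ^ α))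
    {p q : Measure E} [IsProbabilityMeasure p] [IsProbabilityMeasure q]
    (hp : Integrable (fun x => ‖x‖ ^ α) p) (hq : Integrable (fun x => ‖x‖ ^ α) q) :
    MemLp (charFun p - charFun q) 2 ν ∧
      mmdSq (fun x y => -‖x - y‖ ^ α) p q = lpNorm (charFun p - charFun q) 2 ν ^ 2 := by
  obtain ⟨ipq, epq⟩ := integrable_and_integral_one_sub_re_charFun_mul_conj hα hν hp hq
  obtain ⟨ipp, epp⟩ := integrable_and_integral_one_sub_re_charFun_mul_conj hα hν hp hp
  obtain ⟨iqq, eqq⟩ := integrable_and_integral_one_sub_re_charFun_mul_conj hα hν hq hq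
  have hm : AEStronglyMeasurable (charFun p - charFun q) ν :=
    (continuous_charFun.sub continuous_charFun).aestronglyMeasurable
  have hsq : (fun ξ => ‖(charFun p - charFun q) ξ‖ ^ 2) = fun ξ =>
      2 * (1 - (charFun p ξ * conj (charFun q ξ)).re) - (1 - (charFun p ξ * conj (charFun p ξ)).re)
        - (1 - (charFun q ξ * conj (charFun q ξ)).re) := by
    ext ξ
    rw [Complex.sq_norm, Complex.normSq_apply]
    simp only [Pi.sub_apply, Complex.sub_re, Complex.sub_im, Complex.mul_re, Complex.conj_re,
      Complex.conj_im]
    ring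
  refine ⟨(memLp_two_iff_integrable_sq_norm hm).2 ?_, ?_⟩
  · rw [hsq]
    exact ((ipq.const_mul 2).sub ipp).sub iqq
  · rw [lpNorm_eq_integral_norm_rpow_toReal two_ne_zero ENNReal.ofNat_ne_top hm]
    simp only [ENNReal.toReal_ofNat, Real.rpow_ofNat]
    rw [← Real.rpow_natCast, ← Real.rpow_mul (by positivity), Nat.cast_ofNat,
      inv_mul_cancel₀ two_ne_zero, Real.rpow_one, hsq, integral_sub _ iqq, integral_sub _ ipp,
      integral_const_mul, epq, epp, eqq, mmdSq_neg_norm_sub_rpow]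
    · exact ipq.const_mul 2
    · exact (ipq.const_mul 2).sub ipp

end EnergyDistance

/-- the unrectified kernel `k_α(x,y) = -‖x-y‖^α` for `α ∈ (0,2)` yields a metric
(the energy distance) on `P_α(ℝ^d)`. -/
theorem mmd_unrectified_kernel_metric (d : ℕ) (hd : 1 ≤ d) (α : ℝ)
    (hα : α ∈ Set.Ioo (0 : ℝ) 2)
    (k : EuclideanSpace ℝ (Fin d) → EuclideanSpace ℝ (Fin d) → ℝ)
    (hk : ∀ x y, k x y = -‖x - y‖ ^ α)
    (Pα : Set (Measure (EuclideanSpace ℝ (Fin d))))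
    (hPα : ∀ p, p ∈ Pα ↔
      IsProbabilityMeasure p ∧ Integrable (fun x => ‖x‖ ^ α) p) :
    (∀ p ∈ Pα, ∀ q ∈ Pα,
      mmdSq k p q = 2 * (∫ z : _ × _, ‖z.1 - z.2‖ ^ α ∂(p.prod q))
        - (∫ z : _ × _, ‖z.1 - z.2‖ ^ α ∂(p.prod p))
        - ∫ z : _ × _, ‖z.1 - z.2‖ ^ α ∂(q.prod q))
    ∧ (∀ p ∈ Pα, ∀ q ∈ Pα, 0 ≤ mmdSq k p q)
    ∧ (∀ p ∈ Pα, ∀ q ∈ Pα, (mmd k p q = 0 ↔ p = q))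
    ∧ (∀ p ∈ Pα, ∀ q ∈ Pα, mmd k p q = mmd k q p)
    ∧ (∀ p ∈ Pα, ∀ q ∈ Pα, ∀ r ∈ Pα,
        mmd k p q ≤ mmd k p r + mmd k r q) := by
  obtain rfl : k = fun x y => -‖x - y‖ ^ α := funext fun x => funext fun y => hk x y
  have : Nonempty (Fin d) := ⟨⟨0, hd⟩⟩
  obtain ⟨ν, _, hac, hν⟩ :=
    exists_lintegral_one_sub_cos_eq_norm_rpow (E := EuclideanSpace ℝ (Fin d)) hα
  have key : ∀ p ∈ Pα, ∀ q ∈ Pα, MemLp (charFun p - charFun q) 2 ν ∧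
      mmdSq (fun x y => -‖x - y‖ ^ α) p q = lpNorm (charFun p - charFun q) 2 ν ^ 2 := by
    intro p hp q hq
    obtain ⟨_, hp⟩ := (hPα p).1 hp
    obtain ⟨_, hq⟩ := (hPα q).1 hq
    exact memLp_charFun_sub_and_mmdSq_eq_lpNorm_sq hα.1 hν hp hq
  have hmmd : ∀ p ∈ Pα, ∀ q ∈ Pα,
      mmd (fun x y => -‖x - y‖ ^ α) p q = lpNorm (charFun p - charFun q) 2 ν := by
    intro p hp q hq
    rw [mmd, (key p hp q hq).2, Real.sqrt_sq lpNorm_nonneg]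
  refine ⟨fun p _ q _ => mmdSq_neg_norm_sub_rpow α p q, fun p hp q hq => ?_,
    fun p hp q hq => ⟨fun h => ?_, ?_⟩, fun p hp q hq => ?_, fun p hp q hq r hr => ?_⟩
  · rw [(key p hp q hq).2]
    positivity
  · obtain ⟨_, -⟩ := (hPα p).1 hp
    obtain ⟨_, -⟩ := (hPα q).1 hq
    rw [hmmd p hp q hq, lpNorm_eq_zero (key p hp q hq).1 two_ne_zero] at h
    refine Measure.ext_of_charFun ((continuous_charFun.ae_eq_iff_eq volume continuous_charFun).1 ?_)
    exact hac.ae_le ((sub_ae_eq_zero _ _).1 h)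
  · rintro rfl
    simp [hmmd p hp p hp]
  · rw [hmmd p hp q hq, hmmd q hq p hp, lpNorm_sub_comm]
  · rw [hmmd p hp q hq, hmmd p hp r hr, hmmd r hr q hq,
      ← sub_add_sub_cancel (charFun p) (charFun r) (charFun q)]
    exact lpNorm_add_le (key p hp r hr).1 one_le_two
end

section
/- Fix σ > 0 and let k(x, y) := exp(−(x − y)² / (2σ²)) be the Gaussian kernel on ℝ × ℝ. For all Borel probability measures μ and ν on ℝ, MMD²(μ, ν; k) = Σ_{n=0}^∞ (1 / (σ^{2n} n!)) ( m̃_n(μ) − m̃_n(ν) )², where m̃_n(μ) := ∫ e^{−x²/(2σ²)} x^n dμ(x) and m̃_n(ν) := ∫ e^{−x²/(2σ²)} x^n dν(x); in particular the series on the right-hand side converges and MMD²(μ, ν; k) ≥ 0. -/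
open MeasureTheory ProbabilityTheory Filter

/-- Expansion of the Gaussian kernel in the functions `exp (-x² / (2σ²)) xⁿ`. -/
lemma hasSum_gaussian_kernel {σ : ℝ} (hσ : 0 < σ) (x y : ℝ) :
    HasSum (fun n : ℕ => (1 / (σ ^ (2 * n) * (n.factorial : ℝ))) *
      ((Real.exp (-x ^ 2 / (2 * σ ^ 2)) * x ^ n) * (Real.exp (-y ^ 2 / (2 * σ ^ 2)) * y ^ n)))
      (Real.exp (-(x - y) ^ 2 / (2 * σ ^ 2))) := by
  have h : HasSum (fun n : ℕ => (x * y / σ ^ 2) ^ n / (n.factorial : ℝ))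
      (Real.exp (x * y / σ ^ 2)) := by
    rw [Real.exp_eq_exp_ℝ]
    exact NormedSpace.expSeries_div_hasSum_exp _
  convert! h.mul_left (Real.exp (-x ^ 2 / (2 * σ ^ 2)) * Real.exp (-y ^ 2 / (2 * σ ^ 2))) using 1
  · funext n
    rw [div_pow, mul_pow, ← pow_mul]
    field_simp
  · rw [← Real.exp_add, ← Real.exp_add]
    congr 1
    field_simp
    ring

/-- The integral of the Gaussian kernel against a product of finite measures is a series of
products of scaled moments. -/
lemma hasSum_integral_gaussian_kernel {σ : ℝ} (hσ : 0 < σ) (μ ν : Measure ℝ)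
    [IsFiniteMeasure μ] [IsFiniteMeasure ν] :
    HasSum (fun n : ℕ => (1 / (σ ^ (2 * n) * (n.factorial : ℝ))) *
      ((∫ x, Real.exp (-x ^ 2 / (2 * σ ^ 2)) * x ^ n ∂μ) *
        ∫ x, Real.exp (-x ^ 2 / (2 * σ ^ 2)) * x ^ n ∂ν))
      (∫ z : ℝ × ℝ, Real.exp (-(z.1 - z.2) ^ 2 / (2 * σ ^ 2)) ∂(μ.prod ν)) := by
  have habs (z : ℝ × ℝ) := hasSum_gaussian_kernel hσ |z.1| |z.2|
  have h := hasSum_integral_of_dominated_convergence (μ := μ.prod ν)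
    (F := fun (n : ℕ) (z : ℝ × ℝ) => (1 / (σ ^ (2 * n) * (n.factorial : ℝ))) *
      ((Real.exp (-z.1 ^ 2 / (2 * σ ^ 2)) * z.1 ^ n) *
        (Real.exp (-z.2 ^ 2 / (2 * σ ^ 2)) * z.2 ^ n)))
    (fun n z => (1 / (σ ^ (2 * n) * (n.factorial : ℝ))) *
      ((Real.exp (-|z.1| ^ 2 / (2 * σ ^ 2)) * |z.1| ^ n) *
        (Real.exp (-|z.2| ^ 2 / (2 * σ ^ 2)) * |z.2| ^ n)))
    (fun n => by fun_prop)
    (fun n => ae_of_all _ fun z => by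
      simp only [norm_mul, norm_pow, norm_div, Real.norm_eq_abs, abs_one, Nat.abs_cast,
        Real.abs_exp, abs_of_pos hσ, sq_abs, le_refl])
    (ae_of_all _ fun z => (habs z).summable)
    (by
      simp_rw [fun z => (habs z).tsum_eq]
      refine Integrable.of_bound (by fun_prop) 1 (ae_of_all _ fun z => ?_)
      rw [Real.norm_eq_abs, Real.abs_exp, Real.exp_le_one_iff]
      exact div_nonpos_of_nonpos_of_nonneg (neg_nonpos.mpr (sq_nonneg _)) (by positivity))
    (ae_of_all _ fun z => hasSum_gaussian_kernel hσ z.1 z.2)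
  convert! h using 2 with n
  rw [integral_const_mul]
  exact congrArg _ (integral_prod_mul (μ := μ) (ν := ν) _ _).symm

/-- for the Gaussian kernel, `MMD²(μ,ν)` equals the (convergent, nonnegative)
series of squared differences of the scaled moments `m̃_n`. -/
theorem mmdSq_gaussian_eq_moment_series (σ : ℝ) (hσ : 0 < σ)
    (k : ℝ → ℝ → ℝ) (hk : ∀ x y, k x y = Real.exp (-(x - y) ^ 2 / (2 * σ ^ 2)))
    (μ ν : Measure ℝ) [IsProbabilityMeasure μ] [IsProbabilityMeasure ν] :
    Summable (fun n : ℕ => (1 / (σ ^ (2 * n) * (n.factorial : ℝ))) *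
      ((∫ x, Real.exp (-x ^ 2 / (2 * σ ^ 2)) * x ^ n ∂μ) -
        ∫ x, Real.exp (-x ^ 2 / (2 * σ ^ 2)) * x ^ n ∂ν) ^ 2)
    ∧ mmdSq k μ ν = ∑' n : ℕ, (1 / (σ ^ (2 * n) * (n.factorial : ℝ))) *
        ((∫ x, Real.exp (-x ^ 2 / (2 * σ ^ 2)) * x ^ n ∂μ) -
          ∫ x, Real.exp (-x ^ 2 / (2 * σ ^ 2)) * x ^ n ∂ν) ^ 2
    ∧ 0 ≤ mmdSq k μ ν := by
  have hsum : HasSum (fun n : ℕ => (1 / (σ ^ (2 * n) * (n.factorial : ℝ))) *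
      ((∫ x, Real.exp (-x ^ 2 / (2 * σ ^ 2)) * x ^ n ∂μ) -
        ∫ x, Real.exp (-x ^ 2 / (2 * σ ^ 2)) * x ^ n ∂ν) ^ 2) (mmdSq k μ ν) := by
    simp only [mmdSq, hk]
    convert! ((hasSum_integral_gaussian_kernel hσ μ μ).add
      (hasSum_integral_gaussian_kernel hσ ν ν)).sub
      ((hasSum_integral_gaussian_kernel hσ μ ν).mul_left 2) using 2 with n
    ring
  exact ⟨hsum.summable, hsum.tsum_eq.symm, hsum.nonneg fun n => by positivity⟩
end

section
/- Let k : ℝ × ℝ → ℝ be a measurable kernel that is shift invariant, scale sensitive of order α > 0, and conditionally positive. Fix the distributional Bellman setup with discount γ ∈ [0, 1], and let μ, ν be two measurable families of Borel probability measures on ℝ indexed by S × A such that k is integrable with respect to all product measures formed from μ(s,a), ν(s,a), (T^π μ)(s,a) and (T^π ν)(s,a) for every (s,a). Then MMD_∞( T^π μ, T^π ν ; k ) ≤ γ^{α/2} · MMD_∞( μ, ν ; k ). -/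
open MeasureTheory ProbabilityTheory Filter
open scoped ENNReal NNReal

/-- The distributional Bellman operator `T^π`:
`(T^π μ)(s,a) = ∫∫∫ (f_{γ,r})_# μ(s',a') R(dr|s,a) π(da'|s') P(ds'|s,a)`. -/
noncomputable def bellmanOp {S A : Type*} [MeasurableSpace S] [MeasurableSpace A]
    (P : Kernel (S × A) S) (R : Kernel (S × A) ℝ) (pol : Kernel S A) (γ : ℝ)
    (μ : S × A → Measure ℝ) : S × A → Measure ℝ := fun sa =>
  (P sa).bind fun s' => (pol s').bind fun a' => (R sa).bind fun r =>
    (μ (s', a')).map fun z => r + γ * z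

/-- The supremum MMD of two families of return distributions indexed by `S × A`. -/
noncomputable def mmdSup {S A : Type*} [MeasurableSpace S] [MeasurableSpace A]
    (k : ℝ → ℝ → ℝ) (μ ν : S × A → Measure ℝ) : ℝ≥0∞ :=
  ⨆ sa : S × A, ENNReal.ofReal (mmd k (μ sa) (ν sa))

/-- A kernel `k` is conditionally positive if `∫∫ k dχ dχ ≥ 0` for every finite signed Borel
measure `χ` with `χ(ℝ) = 0` (written as `χ = p - q` with `p, q` finite measures of equal total
mass) for which `k` is suitably integrable. -/
def CondPositive (k : ℝ → ℝ → ℝ) : Prop :=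
  ∀ p q : Measure ℝ, IsFiniteMeasure p → IsFiniteMeasure q →
    p Set.univ = q Set.univ →
    Integrable (fun z : ℝ × ℝ => k z.1 z.2) (p.prod p) →
    Integrable (fun z : ℝ × ℝ => k z.1 z.2) (q.prod q) →
    Integrable (fun z : ℝ × ℝ => k z.1 z.2) (p.prod q) →
    0 ≤ mmdSq k p q

/-- The bilinear pairing `∫∫ k d(p ⊗ q)` underlying `mmdSq`. -/
noncomputable def kernelPairing {X : Type*} [MeasurableSpace X] (k : X → X → ℝ)
    (p q : Measure X) : ℝ :=
  ∫ z : X × X, k z.1 z.2 ∂(p.prod q)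

/-- Integrability of `k` with respect to `p ⊗ q`. -/
def PairIntegrable {X : Type*} [MeasurableSpace X] (k : X → X → ℝ) (p q : Measure X) : Prop :=
  Integrable (fun z : X × X => k z.1 z.2) (p.prod q)

section Pairing

variable {X : Type*} [MeasurableSpace X] {k : X → X → ℝ}

theorem mmdSq_eq_kernelPairing (p q : Measure X) :
    mmdSq k p q = kernelPairing k p p + kernelPairing k q q - 2 * kernelPairing k p q :=
  rfl

theorem kernelPairing_comm (hk : ∀ x y, k x y = k y x) (p q : Measure X) [SFinite p] [SFinite q] :
    kernelPairing k p q = kernelPairing k q p := by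
  unfold kernelPairing
  rw [← integral_prod_swap]
  simp only [Prod.fst_swap, Prod.snd_swap]
  exact integral_congr_ae (.of_forall fun z => hk _ _)

theorem PairIntegrable.symm (hk : ∀ x y, k x y = k y x) {p q : Measure X} [SFinite p] [SFinite q]
    (h : PairIntegrable k p q) : PairIntegrable k q p :=
  h.swap.congr (.of_forall fun _ => hk _ _)

theorem PairIntegrable.add_left {p q r : Measure X} [SFinite p] [SFinite q] [SFinite r]
    (hp : PairIntegrable k p r) (hq : PairIntegrable k q r) : PairIntegrable k (p + q) r := by
  unfold PairIntegrable at *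
  rw [Measure.add_prod]
  exact hp.add_measure hq

theorem PairIntegrable.add_right {p q r : Measure X} [SFinite p] [SFinite q] [SFinite r]
    (hp : PairIntegrable k r p) (hq : PairIntegrable k r q) : PairIntegrable k r (p + q) := by
  unfold PairIntegrable at *
  rw [Measure.prod_add]
  exact hp.add_measure hq

theorem kernelPairing_add_left {p q r : Measure X} [SFinite p] [SFinite q] [SFinite r]
    (hp : PairIntegrable k p r) (hq : PairIntegrable k q r) :
    kernelPairing k (p + q) r = kernelPairing k p r + kernelPairing k q r := by
  unfold kernelPairing
  rw [Measure.add_prod, integral_add_measure hp hq]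

theorem kernelPairing_add_right {p q r : Measure X} [SFinite p] [SFinite q] [SFinite r]
    (hp : PairIntegrable k r p) (hq : PairIntegrable k r q) :
    kernelPairing k r (p + q) = kernelPairing k r p + kernelPairing k r q := by
  unfold kernelPairing
  rw [Measure.prod_add, integral_add_measure hp hq]

end Pairing

/-- Polarized form of conditional positivity: twice the pairing of `p - q` with `p' - q'` is at
most the sum of the two squared discrepancies. -/
theorem CondPositive.two_mul_cross_le {k : ℝ → ℝ → ℝ} (hpos : CondPositive k)
    (hk : ∀ x y, k x y = k y x) {p q p' q' : Measure ℝ}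
    [IsProbabilityMeasure p] [IsProbabilityMeasure q]
    [IsProbabilityMeasure p'] [IsProbabilityMeasure q']
    (hpp : PairIntegrable k p p) (hqq : PairIntegrable k q q) (hpq : PairIntegrable k p q)
    (hpp' : PairIntegrable k p' p') (hqq' : PairIntegrable k q' q') (hpq' : PairIntegrable k p' q')
    (h₁ : PairIntegrable k p p') (h₂ : PairIntegrable k q q')
    (h₃ : PairIntegrable k p q') (h₄ : PairIntegrable k q p') :
    2 * (kernelPairing k p p' + kernelPairing k q q' - kernelPairing k p q' -
      kernelPairing k q p') ≤ mmdSq k p q + mmdSq k p' q' := by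
  have hqp' := hpq'.symm hk
  have h₂' := h₂.symm hk
  have h₃' := h₃.symm hk
  have h₄' := h₄.symm hk
  have key := hpos (p + q') (q + p') inferInstance inferInstance (by simp)
    ((hpp.add_right h₃).add_left (h₃'.add_right hqq'))
    ((hqq.add_right h₄).add_left (h₄'.add_right hpp'))
    ((hpq.add_right h₁).add_left (h₂'.add_right hqp'))
  rw [mmdSq_eq_kernelPairing,
    kernelPairing_add_left (hpp.add_right h₃) (h₃'.add_right hqq'),
    kernelPairing_add_left (hqq.add_right h₄) (h₄'.add_right hpp'),
    kernelPairing_add_left (hpq.add_right h₁) (h₂'.add_right hqp'),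
    kernelPairing_add_right hpp h₃, kernelPairing_add_right h₃' hqq',
    kernelPairing_add_right hqq h₄, kernelPairing_add_right h₄' hpp',
    kernelPairing_add_right hpq h₁, kernelPairing_add_right h₂' hqp',
    kernelPairing_comm hk q' p, kernelPairing_comm hk p' q, kernelPairing_comm hk q' q,
    kernelPairing_comm hk q' p'] at key
  rw [mmdSq_eq_kernelPairing, mmdSq_eq_kernelPairing]
  linarith

section Mixture

variable {Ω X : Type*} [MeasurableSpace Ω] [MeasurableSpace X]

theorem prod_bind_kernel (ρ : Measure Ω) [SFinite ρ] (κ η : Kernel Ω X)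
    [IsSFiniteKernel κ] [IsSFiniteKernel η] :
    (ρ.bind κ).prod (ρ.bind η) = (ρ.prod ρ).bind (κ ∥ₖ η) := by
  rw [Measure.prod_comp_left, Measure.prod_comp_right, Measure.comp_assoc,
    Kernel.parallelComp_comp_parallelComp, Kernel.comp_id, Kernel.id_comp]

theorem PairIntegrable.mixture {k : X → X → ℝ} {ρ : Measure Ω} [SFinite ρ] {κ η : Kernel Ω X}
    [IsSFiniteKernel κ] [IsSFiniteKernel η] (h : PairIntegrable k (ρ.bind κ) (ρ.bind η)) :
    (∀ᵐ w ∂(ρ.prod ρ), PairIntegrable k (κ w.1) (η w.2)) ∧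
    Integrable (fun w : Ω × Ω => kernelPairing k (κ w.1) (η w.2)) (ρ.prod ρ) ∧
    kernelPairing k (ρ.bind κ) (ρ.bind η) =
      ∫ w : Ω × Ω, kernelPairing k (κ w.1) (η w.2) ∂(ρ.prod ρ) := by
  unfold PairIntegrable kernelPairing at *
  rw [prod_bind_kernel] at h ⊢
  simp_rw [← Kernel.parallelComp_apply]
  refine ⟨Measure.ae_integrable_of_integrable_comp h, ?_, ?_⟩
  · rw [Measure.comp_eq_comp_const_apply] at h
    simpa using h.integral_comp
  · rw [Measure.comp_eq_comp_const_apply] at h ⊢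
    simpa using Kernel.integral_comp h

end Mixture

/-- The squared discrepancy of two mixtures with the same mixing law is at most any uniform bound
on the squared discrepancies of their components. -/
theorem CondPositive.mmdSq_mixture_le {Ω : Type*} [MeasurableSpace Ω] {k : ℝ → ℝ → ℝ}
    (hpos : CondPositive k) (hk : ∀ x y, k x y = k y x)
    (ρ : Measure Ω) [IsProbabilityMeasure ρ] (κ η : Kernel Ω ℝ)
    [IsMarkovKernel κ] [IsMarkovKernel η]
    (hκκ : PairIntegrable k (ρ.bind κ) (ρ.bind κ)) (hηη : PairIntegrable k (ρ.bind η) (ρ.bind η))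
    (hκη : PairIntegrable k (ρ.bind κ) (ρ.bind η))
    (hκκ' : ∀ w, PairIntegrable k (κ w) (κ w)) (hηη' : ∀ w, PairIntegrable k (η w) (η w))
    (hκη' : ∀ w, PairIntegrable k (κ w) (η w))
    {C : ℝ} (hC : ∀ w, mmdSq k (κ w) (η w) ≤ C) :
    mmdSq k (ρ.bind κ) (ρ.bind η) ≤ C := by
  have hηκ := hκη.symm hk
  obtain ⟨a₁, i₁, e₁⟩ := hκκ.mixture
  obtain ⟨a₂, i₂, e₂⟩ := hηη.mixture
  obtain ⟨a₃, i₃, e₃⟩ := hκη.mixture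
  obtain ⟨a₄, i₄, e₄⟩ := hηκ.mixture
  have heq : mmdSq k (ρ.bind κ) (ρ.bind η) = ∫ w : Ω × Ω,
      (kernelPairing k (κ w.1) (κ w.2) + kernelPairing k (η w.1) (η w.2) -
        kernelPairing k (κ w.1) (η w.2) - kernelPairing k (η w.1) (κ w.2)) ∂(ρ.prod ρ) := by
    rw [integral_sub (by exact (i₁.add i₂).sub i₃) i₄, integral_sub (by exact i₁.add i₂) i₃,
      integral_add i₁ i₂, ← e₁, ← e₂, ← e₃, ← e₄, kernelPairing_comm hk (ρ.bind η) (ρ.bind κ),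
      mmdSq_eq_kernelPairing]
    ring
  calc mmdSq k (ρ.bind κ) (ρ.bind η) ≤ ∫ _ : Ω × Ω, C ∂(ρ.prod ρ) := by
        rw [heq]
        refine integral_mono_ae (((i₁.add i₂).sub i₃).sub i₄) (integrable_const C) ?_
        filter_upwards [a₁, a₂, a₃, a₄] with w h₁ h₂ h₃ h₄
        have := hpos.two_mul_cross_le hk (hκκ' w.1) (hηη' w.1) (hκη' w.1)
          (hκκ' w.2) (hηη' w.2) (hκη' w.2) h₁ h₂ h₃ h₄
        linarith [hC w.1, hC w.2]
    _ = C := by simp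

section Affine

variable {k : ℝ → ℝ → ℝ} {α : ℝ}

theorem kernel_affine (hshift : ∀ x y c : ℝ, k (x + c) (y + c) = k x y)
    (hscale : ∀ x y c : ℝ, k (c * x) (c * y) = |c| ^ α * k x y) (r γ x y : ℝ) :
    k (r + γ * x) (r + γ * y) = |γ| ^ α * k x y := by
  rw [add_comm r, add_comm r, hshift, hscale]

theorem kernel_symm (hshift : ∀ x y c : ℝ, k (x + c) (y + c) = k x y)
    (hscale : ∀ x y c : ℝ, k (c * x) (c * y) = |c| ^ α * k x y) (x y : ℝ) :
    k x y = k y x := by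
  have := kernel_affine hshift hscale (x + y) (-1) y x
  simpa using this

theorem map_prod_map_affine (p q : Measure ℝ) [SFinite p] [SFinite q] (r γ : ℝ) :
    (p.map fun z => r + γ * z).prod (q.map fun z => r + γ * z) =
      (p.prod q).map (Prod.map (fun z => r + γ * z) fun z => r + γ * z) :=
  Measure.map_prod_map p q (by fun_prop) (by fun_prop)

theorem PairIntegrable.map_affine (hkm : Measurable fun z : ℝ × ℝ => k z.1 z.2)
    (hshift : ∀ x y c : ℝ, k (x + c) (y + c) = k x y)
    (hscale : ∀ x y c : ℝ, k (c * x) (c * y) = |c| ^ α * k x y)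
    {p q : Measure ℝ} [SFinite p] [SFinite q] (h : PairIntegrable k p q) (r γ : ℝ) :
    PairIntegrable k (p.map fun z => r + γ * z) (q.map fun z => r + γ * z) := by
  unfold PairIntegrable at *
  rw [map_prod_map_affine,
    integrable_map_measure hkm.aestronglyMeasurable (by fun_prop)]
  simp only [Function.comp_def, Prod.map_fst, Prod.map_snd, kernel_affine hshift hscale]
  exact h.const_mul _

theorem kernelPairing_map_affine (hkm : Measurable fun z : ℝ × ℝ => k z.1 z.2)
    (hshift : ∀ x y c : ℝ, k (x + c) (y + c) = k x y)
    (hscale : ∀ x y c : ℝ, k (c * x) (c * y) = |c| ^ α * k x y)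
    (p q : Measure ℝ) [SFinite p] [SFinite q] (r γ : ℝ) :
    kernelPairing k (p.map fun z => r + γ * z) (q.map fun z => r + γ * z) =
      |γ| ^ α * kernelPairing k p q := by
  unfold kernelPairing
  rw [map_prod_map_affine,
    integral_map (by fun_prop) hkm.aestronglyMeasurable]
  simp only [Prod.map_fst, Prod.map_snd, kernel_affine hshift hscale]
  exact integral_const_mul _ _

theorem mmdSq_map_affine (hkm : Measurable fun z : ℝ × ℝ => k z.1 z.2)
    (hshift : ∀ x y c : ℝ, k (x + c) (y + c) = k x y)
    (hscale : ∀ x y c : ℝ, k (c * x) (c * y) = |c| ^ α * k x y)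
    (p q : Measure ℝ) [SFinite p] [SFinite q] (r γ : ℝ) :
    mmdSq k (p.map fun z => r + γ * z) (q.map fun z => r + γ * z) = |γ| ^ α * mmdSq k p q := by
  simp only [mmdSq_eq_kernelPairing, kernelPairing_map_affine hkm hshift hscale]
  ring

theorem mmd_map_affine (hkm : Measurable fun z : ℝ × ℝ => k z.1 z.2)
    (hshift : ∀ x y c : ℝ, k (x + c) (y + c) = k x y)
    (hscale : ∀ x y c : ℝ, k (c * x) (c * y) = |c| ^ α * k x y)
    (p q : Measure ℝ) [SFinite p] [SFinite q] (r : ℝ) {γ : ℝ} (hγ : 0 ≤ γ) :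
    mmd k (p.map fun z => r + γ * z) (q.map fun z => r + γ * z) = γ ^ (α / 2) * mmd k p q := by
  rw [mmd, mmd, mmdSq_map_affine hkm hshift hscale, abs_of_nonneg hγ,
    Real.sqrt_mul (Real.rpow_nonneg hγ α), Real.sqrt_eq_rpow, ← Real.rpow_mul hγ, mul_one_div]

end Affine

/-- The kernel sending a state-action pair and a reward `r` to the law of `r + γ z`, `z ∼ μ`. -/
noncomputable def affineKernel {Y : Type*} [MeasurableSpace Y] (μ : Kernel Y ℝ) (γ : ℝ) :
    Kernel (Y × ℝ) ℝ :=
  (Kernel.id ×ₖ μ.comap Prod.fst measurable_fst).map fun w : (Y × ℝ) × ℝ => w.1.2 + γ * w.2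

theorem affineKernel_apply {Y : Type*} [MeasurableSpace Y] (μ : Kernel Y ℝ) [IsSFiniteKernel μ]
    (γ : ℝ) (w : Y × ℝ) : affineKernel μ γ w = (μ w.1).map fun z => w.2 + γ * z := by
  rw [affineKernel, Kernel.map_apply _ (by fun_prop), Kernel.prod_apply, Kernel.id_apply,
    Kernel.comap_apply, Measure.dirac_prod, Measure.map_map (by fun_prop) (by fun_prop)]
  rfl

instance {Y : Type*} [MeasurableSpace Y] (μ : Kernel Y ℝ) [IsMarkovKernel μ] (γ : ℝ) :
    IsMarkovKernel (affineKernel μ γ) :=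
  Kernel.IsMarkovKernel.map _ (by fun_prop)

section Bellman

variable {S A : Type*} [MeasurableSpace S] [MeasurableSpace A]

/-- The joint law of the next state, the next action and the reward. -/
noncomputable def stepLaw (P : Kernel (S × A) S) (R : Kernel (S × A) ℝ) (pol : Kernel S A)
    (sa : S × A) : Measure ((S × A) × ℝ) :=
  ((P sa) ⊗ₘ pol).prod (R sa)

instance (P : Kernel (S × A) S) [IsMarkovKernel P] (R : Kernel (S × A) ℝ) [IsMarkovKernel R]
    (pol : Kernel S A) [IsMarkovKernel pol] (sa : S × A) :
    IsProbabilityMeasure (stepLaw P R pol sa) := by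
  unfold stepLaw
  infer_instance

theorem bellmanOp_eq_bind (P : Kernel (S × A) S) [IsMarkovKernel P]
    (R : Kernel (S × A) ℝ) [IsMarkovKernel R] (pol : Kernel S A) [IsMarkovKernel pol] (γ : ℝ)
    (μ : Kernel (S × A) ℝ) [IsMarkovKernel μ] (sa : S × A) :
    bellmanOp P R pol γ μ sa = (stepLaw P R pol sa).bind (affineKernel μ γ) := by
  have h₁ : Measurable fun x : S × A => (R sa).bind fun r => affineKernel μ γ (x, r) := by
    refine Measure.measurable_of_measurable_coe _ fun B hB => ?_
    have h : (fun x : S × A => ((R sa).bind fun r => affineKernel μ γ (x, r)) B) =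
        fun x => ∫⁻ r, affineKernel μ γ (x, r) B ∂(R sa) := funext fun _ => Measure.bind_apply hB
      ((affineKernel μ γ).measurable.comp measurable_prodMk_left).aemeasurable
    rw [h]
    exact ((affineKernel μ γ).measurable_coe hB).lintegral_prod_right'
  have h₂ : Measurable fun s : S =>
      (pol s).bind fun a => (R sa).bind fun r => affineKernel μ γ ((s, a), r) := by
    refine Measure.measurable_of_measurable_coe _ fun B hB => ?_
    have h : (fun s : S =>
        ((pol s).bind fun a => (R sa).bind fun r => affineKernel μ γ ((s, a), r)) B) =
        fun s => ∫⁻ a, ((R sa).bind fun r => affineKernel μ γ ((s, a), r)) B ∂pol s :=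
      funext fun _ => Measure.bind_apply hB (h₁.comp measurable_prodMk_left).aemeasurable
    rw [h]
    exact Measurable.lintegral_kernel_prod_right' ((Measure.measurable_coe hB).comp h₁)
  have hop : bellmanOp P R pol γ μ sa = (P sa).bind fun s =>
      (pol s).bind fun a => (R sa).bind fun r => affineKernel μ γ ((s, a), r) := by
    simp only [bellmanOp, affineKernel_apply]
  ext B hB
  have hB' := (affineKernel μ γ).measurable_coe hB
  rw [hop, Measure.bind_apply hB h₂.aemeasurable,
    Measure.bind_apply hB (affineKernel μ γ).aemeasurable, stepLaw,
    lintegral_prod _ hB'.aemeasurable, Measure.lintegral_compProd hB'.lintegral_prod_right']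
  refine lintegral_congr fun s => ?_
  refine (Measure.bind_apply hB (h₁.comp measurable_prodMk_left).aemeasurable).trans ?_
  refine lintegral_congr fun a => ?_
  exact Measure.bind_apply hB
    ((affineKernel μ γ).measurable.comp measurable_prodMk_left).aemeasurable

end Bellman

/-- for a shift-invariant, scale-sensitive (order `α > 0`), conditionally
positive kernel, the distributional Bellman operator is a `γ^{α/2}`-contraction in `MMD_∞`. -/
theorem bellman_contraction_shift_invariant_scale_sensitive
    {S A : Type*} [MeasurableSpace S] [MeasurableSpace A]
    (k : ℝ → ℝ → ℝ) (hkm : Measurable fun z : ℝ × ℝ => k z.1 z.2)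
    (α : ℝ) (hα : 0 < α)
    (hshift : ∀ x y c : ℝ, k (x + c) (y + c) = k x y)
    (hscale : ∀ x y c : ℝ, k (c * x) (c * y) = |c| ^ α * k x y)
    (hpos : CondPositive k)
    (P : Kernel (S × A) S) [IsMarkovKernel P]
    (R : Kernel (S × A) ℝ) [IsMarkovKernel R]
    (pol : Kernel S A) [IsMarkovKernel pol]
    (γ : ℝ) (hγ : γ ∈ Set.Icc (0 : ℝ) 1)
    (μ ν : S × A → Measure ℝ) (hμm : Measurable μ) (hνm : Measurable ν)
    (hμp : ∀ sa, IsProbabilityMeasure (μ sa)) (hνp : ∀ sa, IsProbabilityMeasure (ν sa))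
    (hint : ∀ sa : S × A,
      ∀ p ∈ ({μ sa, ν sa, bellmanOp P R pol γ μ sa, bellmanOp P R pol γ ν sa} :
        Set (Measure ℝ)),
      ∀ q ∈ ({μ sa, ν sa, bellmanOp P R pol γ μ sa, bellmanOp P R pol γ ν sa} :
        Set (Measure ℝ)),
      Integrable (fun z : ℝ × ℝ => k z.1 z.2) (p.prod q)) :
    mmdSup k (bellmanOp P R pol γ μ) (bellmanOp P R pol γ ν)
      ≤ ENNReal.ofReal (γ ^ (α / 2)) * mmdSup k μ ν := by
  have hsymm := kernel_symm hshift hscale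
  let κ : Kernel (S × A) ℝ := ⟨μ, hμm⟩
  let η : Kernel (S × A) ℝ := ⟨ν, hνm⟩
  have : IsMarkovKernel κ := ⟨hμp⟩
  have : IsMarkovKernel η := ⟨hνp⟩
  have hγ0 : 0 ≤ γ := hγ.1
  set D := ENNReal.ofReal (γ ^ (α / 2)) * mmdSup k μ ν with hD
  rcases eq_or_ne D ⊤ with htop | htop
  · rw [htop]
    exact le_top
  refine iSup_le fun sa => ENNReal.ofReal_le_of_le_toReal (Real.sqrt_le_iff.2
    ⟨ENNReal.toReal_nonneg, ?_⟩)
  have hκ : bellmanOp P R pol γ μ sa = (stepLaw P R pol sa).bind (affineKernel κ γ) :=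
    bellmanOp_eq_bind P R pol γ κ sa
  have hη : bellmanOp P R pol γ ν sa = (stepLaw P R pol sa).bind (affineKernel η γ) :=
    bellmanOp_eq_bind P R pol γ η sa
  have hint' := hint sa
  rw [hκ, hη] at hint'
  rw [hκ, hη]
  refine hpos.mmdSq_mixture_le hsymm _ _ _ (hint' _ (by simp) _ (by simp))
    (hint' _ (by simp) _ (by simp)) (hint' _ (by simp) _ (by simp)) ?_ ?_ ?_ ?_
  all_goals
    intro w
    simp only [affineKernel_apply]
  · exact PairIntegrable.map_affine hkm hshift hscale
      (hint w.1 (μ w.1) (by simp) (μ w.1) (by simp)) _ _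
  · exact PairIntegrable.map_affine hkm hshift hscale
      (hint w.1 (ν w.1) (by simp) (ν w.1) (by simp)) _ _
  · exact PairIntegrable.map_affine hkm hshift hscale
      (hint w.1 (μ w.1) (by simp) (ν w.1) (by simp)) _ _
  · refine (Real.sqrt_le_left ENNReal.toReal_nonneg).1 ?_
    change mmd k ((κ w.1).map _) ((η w.1).map _) ≤ _
    rw [mmd_map_affine hkm hshift hscale _ _ _ hγ0, ← ENNReal.ofReal_le_iff_le_toReal htop,
      ENNReal.ofReal_mul (Real.rpow_nonneg hγ0 _)]
    exact mul_le_mul_right (le_iSup (fun x => ENNReal.ofReal (mmd k (μ x) (ν x))) w.1) _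
end

section
/- The distributional Bellman operator is not a contraction in supremum MMD with the Gaussian kernel: for every σ > 0 and every α > 0, there exist a finite state space S, a finite action space A, Markov kernels P (transitions) and R (rewards, with R(·|s,a) finitely supported), a policy kernel π, a discount γ ∈ (0, 1), and two measurable families μ, ν of finitely supported Borel probability measures on ℝ indexed by S × A, such that, with k(x, y) := exp(−(x − y)²/(2σ²)), MMD_∞( T^π μ, T^π ν ; k ) > γ^α · MMD_∞( μ, ν ; k ). The same statement holds with the exp-prod kernel k(x, y) := exp(x y / σ²) in place of the Gaussian kernel. -/
open MeasureTheory ProbabilityTheory Filter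
open scoped ENNReal NNReal

/-- The distributional Bellman operator fails the `γ^α`-contraction property in `MMD_∞` with
kernel `k`: there is an MDP with finite state and action spaces, a finitely supported reward
kernel, a discount `γ ∈ (0,1)`, and finitely supported return-distribution families `μ, ν`
witnessing `MMD_∞(T^π μ, T^π ν) > γ^α MMD_∞(μ, ν)`. -/
def BellmanNotContraction (k : ℝ → ℝ → ℝ) (α : ℝ) : Prop :=
  ∃ (nS nA : ℕ) (P : Kernel (Fin nS × Fin nA) (Fin nS))
    (R : Kernel (Fin nS × Fin nA) ℝ) (pol : Kernel (Fin nS) (Fin nA)) (γ : ℝ)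
    (μ ν : Fin nS × Fin nA → Measure ℝ),
    IsMarkovKernel P ∧ IsMarkovKernel R ∧ IsMarkovKernel pol ∧
    γ ∈ Set.Ioo (0 : ℝ) 1 ∧
    (∀ sa, IsProbabilityMeasure (μ sa)) ∧ (∀ sa, IsProbabilityMeasure (ν sa)) ∧
    (∀ sa, ∃ t : Finset ℝ, μ sa ((↑t : Set ℝ)ᶜ) = 0) ∧
    (∀ sa, ∃ t : Finset ℝ, ν sa ((↑t : Set ℝ)ᶜ) = 0) ∧
    (∀ sa, ∃ t : Finset ℝ, R sa ((↑t : Set ℝ)ᶜ) = 0) ∧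
    ENNReal.ofReal (γ ^ α) * mmdSup k μ ν
      < mmdSup k (bellmanOp P R pol γ μ) (bellmanOp P R pol γ ν)

theorem mmdSq_dirac (k : ℝ → ℝ → ℝ) (a b : ℝ) :
    mmdSq k (Measure.dirac a) (Measure.dirac b) = k a a + k b b - 2 * k a b := by
  simp [mmdSq, Measure.dirac_prod_dirac]

/-- With deterministic reward `r` and a single state-action pair, the Bellman operator maps
`δ_a` to `δ_{r + γ a}`. -/
theorem bellmanOp_dirac {S A : Type*} [MeasurableSpace S] [MeasurableSpace A]
    (P : Kernel (S × A) S) (pol : Kernel S A) [IsMarkovKernel P] [IsMarkovKernel pol]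
    (r γ a : ℝ) (sa : S × A) :
    bellmanOp P (Kernel.const _ (Measure.dirac r)) pol γ (fun _ => Measure.dirac a) sa =
      Measure.dirac (r + γ * a) := by
  have h (x : ℝ) : (Measure.dirac a).map (fun z => x + γ * z) = Measure.dirac (x + γ * a) :=
    Measure.map_dirac' (by fun_prop) a
  have hm : Measurable fun x : ℝ => Measure.dirac (x + γ * a) :=
    Measure.measurable_dirac.comp (by fun_prop)
  simp [bellmanOp, h, Measure.dirac_bind hm]

/-- A kernel whose squared MMD between two point masses shrinks by less than `γ ^ (2 α)` under
an affine map `z ↦ r + γ z` fails the contraction property. -/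
theorem bellmanNotContraction_of_dirac {k : ℝ → ℝ → ℝ} {α : ℝ} (γ r a b : ℝ)
    (hγ : γ ∈ Set.Ioo (0 : ℝ) 1) (h_nonneg : 0 ≤ k a a + k b b - 2 * k a b)
    (h_lt : (γ ^ α) ^ 2 * (k a a + k b b - 2 * k a b) <
      k (r + γ * a) (r + γ * a) + k (r + γ * b) (r + γ * b) - 2 * k (r + γ * a) (r + γ * b)) :
    BellmanNotContraction k α := by
  have hpow : 0 ≤ γ ^ α := Real.rpow_nonneg hγ.1.le α
  refine ⟨1, 1, Kernel.const _ (Measure.dirac 0), Kernel.const _ (Measure.dirac r),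
    Kernel.const _ (Measure.dirac 0), γ, fun _ => Measure.dirac a, fun _ => Measure.dirac b,
    inferInstance, inferInstance, inferInstance, hγ, fun _ => inferInstance,
    fun _ => inferInstance, fun _ => ⟨{a}, by simp⟩, fun _ => ⟨{b}, by simp⟩,
    fun _ => ⟨{r}, by simp⟩, ?_⟩
  simp only [mmdSup, bellmanOp_dirac, mmd, mmdSq_dirac, ciSup_const]
  rw [← ENNReal.ofReal_mul hpow]
  have hlt := Real.sqrt_lt_sqrt (mul_nonneg (sq_nonneg _) h_nonneg) h_lt
  rw [Real.sqrt_mul (sq_nonneg _), Real.sqrt_sq hpow] at hlt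
  exact (ENNReal.ofReal_lt_ofReal_iff_of_nonneg
    (mul_nonneg hpow (Real.sqrt_nonneg _))).2 hlt

theorem half_rpow_sq_lt_one {α : ℝ} (hα : 0 < α) : (((1 : ℝ) / 2) ^ α) ^ 2 < 1 :=
  pow_lt_one₀ (by positivity) (Real.rpow_lt_one (by norm_num) (by norm_num) hα) two_ne_zero

theorem bellmanNotContraction_gaussian {σ α : ℝ} (hσ : 0 < σ) (hα : 0 < α) :
    BellmanNotContraction (fun x y => Real.exp (-(x - y) ^ 2 / (2 * σ ^ 2))) α := by
  have hc := half_rpow_sq_lt_one hα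
  have hc_nonneg : 0 ≤ (((1 : ℝ) / 2) ^ α) ^ 2 := by positivity
  set c := (((1 : ℝ) / 2) ^ α) ^ 2 with hc_def
  set t := -Real.log ((1 - c) / 2) with ht_def
  have ht : 0 ≤ t := neg_nonneg.2 (Real.log_nonpos (by linarith) (by linarith))
  have hexp : Real.exp (-t) = (1 - c) / 2 := by
    rw [ht_def, neg_neg, Real.exp_log (by linarith)]
  have hsq : Real.sqrt (8 * t) ^ 2 = 8 * t := Real.sq_sqrt (by positivity)
  have hfar : -(0 - σ * Real.sqrt (8 * t)) ^ 2 / (2 * σ ^ 2) = -(4 * t) := by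
    field_simp
    linear_combination (-σ ^ 2) * hsq
  have hnear : -(0 + 1 / 2 * 0 - (0 + 1 / 2 * (σ * Real.sqrt (8 * t)))) ^ 2 / (2 * σ ^ 2) =
      -t := by
    field_simp
    linear_combination (-σ ^ 2) * hsq
  have hpos := Real.exp_pos (-(4 * t))
  have hle : Real.exp (-(4 * t)) ≤ 1 := Real.exp_le_one_iff.2 (by linarith)
  refine bellmanNotContraction_of_dirac (1 / 2) 0 0 (σ * Real.sqrt (8 * t)) (by norm_num) ?_ ?_
  · simp only [hfar, sub_self]
    norm_num
    linarith
  · simp only [hfar, hnear, hexp, sub_self, ← hc_def]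
    norm_num
    nlinarith

theorem bellmanNotContraction_exp_prod {σ α : ℝ} (hσ : 0 < σ) (hα : 0 < α) :
    BellmanNotContraction (fun x y => Real.exp (x * y / σ ^ 2)) α := by
  have hc := half_rpow_sq_lt_one hα
  obtain ⟨s, hs, hs_def⟩ : ∃ s : ℝ, 0 < s ∧ ∀ x : ℝ, x / σ ^ 2 = x * s :=
    ⟨(σ ^ 2)⁻¹, by positivity, fun x => div_eq_mul_inv _ _⟩
  have hone : 1 < Real.exp s := Real.one_lt_exp_iff.2 hs
  set r : ℝ := 1 + 2 / s with hr_def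
  have hrs : r * s = s + 2 := by rw [hr_def]; field_simp
  set y := Real.exp (s / 4) with hy_def
  have hy : 1 < y := Real.one_lt_exp_iff.2 (by positivity)
  have hy4 : Real.exp s = y ^ 4 := by rw [hy_def, ← Real.exp_nat_mul]; congr 1; push_cast; ring
  set v := Real.exp (r * s / 2) with hv_def
  have hv2 : 4 * y ^ 4 ≤ v ^ 2 := by
    have h2 : v ^ 2 = y ^ 4 * Real.exp 1 ^ 2 := by
      rw [← hy4, hv_def, ← Real.exp_nat_mul, ← Real.exp_nat_mul, ← Real.exp_add]
      congr 1; push_cast; linarith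
    have h1 : (2 : ℝ) ≤ Real.exp 1 := by linarith [Real.add_one_le_exp 1]
    rw [h2]
    have h3 : (4 : ℝ) ≤ Real.exp 1 ^ 2 := by nlinarith
    linarith [mul_le_mul_of_nonneg_left h3 (by positivity : 0 ≤ y ^ 4)]
  have hw : 1 ≤ Real.exp (r * r * s) :=
    Real.one_le_exp (mul_nonneg (mul_self_nonneg r) hs.le)
  have hmid : Real.exp ((r + 1 / 2 * 0) * (r + 1 / 2 * 1) * s) = Real.exp (r * r * s) * v := by
    rw [hv_def, ← Real.exp_add]; congr 1; ring
  have hend : Real.exp ((r + 1 / 2 * 1) * (r + 1 / 2 * 1) * s) =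
      Real.exp (r * r * s) * v ^ 2 * y := by
    rw [hv_def, hy_def, ← Real.exp_nat_mul, ← Real.exp_add, ← Real.exp_add]
    congr 1; push_cast; ring
  have hstart : (r + 1 / 2 * 0) * (r + 1 / 2 * 0) = r * r := by ring
  have hgap : y ^ 4 - 1 ≤ 1 + v ^ 2 * y - 2 * v := by
    have h1 : y ^ 4 - 1 ≤ 4 * y ^ 4 * (y - 1) := by
      have h3 : 1 + y + y ^ 2 + y ^ 3 ≤ 4 * y ^ 4 := by
        have e1 : 1 ≤ y ^ 4 := one_le_pow₀ hy.le
        have e2 : y ^ 1 ≤ y ^ 4 := pow_le_pow_right₀ hy.le (by norm_num)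
        have e3 : y ^ 2 ≤ y ^ 4 := pow_le_pow_right₀ hy.le (by norm_num)
        have e4 : y ^ 3 ≤ y ^ 4 := pow_le_pow_right₀ hy.le (by norm_num)
        linarith
      linarith [mul_le_mul_of_nonneg_right h3 (sub_nonneg.2 hy.le)]
    linarith [mul_le_mul_of_nonneg_right hv2 (sub_nonneg.2 hy.le), sq_nonneg (v - 1)]
  refine bellmanNotContraction_of_dirac (1 / 2) r 0 1 (by norm_num) ?_ ?_
  · simp only [hs_def]
    norm_num
    linarith
  · simp only [hs_def, hmid, hend, hstart]
    norm_num only [mul_zero, zero_mul, Real.exp_zero, one_mul, mul_one, hy4]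
    rw [hy4] at hone
    calc _ < 1 * (y ^ 4 - 1) := by
          refine lt_of_eq_of_lt ?_ (mul_lt_mul_of_pos_right hc (sub_pos.2 hone))
          ring
      _ ≤ Real.exp (r * r * s) * (1 + v ^ 2 * y - 2 * v) :=
          mul_le_mul hw hgap (by linarith) (Real.exp_pos _).le
      _ = _ := by ring

/-- the distributional Bellman operator is not a contraction in supremum MMD for
the Gaussian kernel, nor for the exp-prod kernel. -/
theorem bellman_not_contraction_gaussian_and_exp_prod :
    ∀ σ : ℝ, 0 < σ → ∀ α : ℝ, 0 < α →
      BellmanNotContraction (fun x y => Real.exp (-(x - y) ^ 2 / (2 * σ ^ 2))) α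
      ∧ BellmanNotContraction (fun x y => Real.exp (x * y / σ ^ 2)) α :=
  fun _ hσ _ hα => ⟨bellmanNotContraction_gaussian hσ hα, bellmanNotContraction_exp_prod hσ hα⟩
end
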